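/- arXiv:math/9905136 — 3 statements merged into one kernel-verified Lean document; each statement's English description precedes it below -/
import Mathlib

section
/- (Index theorem for two variable endpoints, ODE model.) Assume W_Q ⊆ {J(b) : J a P-Jacobi field}. Then for every subspace 𝒱 of H^{(P,Q)} containing 𝒥^Q one has ind(I^{(P,Q)}, 𝒱) = ind(I^P, 𝒱 ∩ H^P) + ind(A, 𝒥^Q) (an identity in ℕ ∪ {∞}). -/
open Set

/-- `J` is a Jacobi field (in the ODE model) with derivative `J'`:
`J` is twice differentiable and `J'' = S J`. -/
def IsJacobiPair {n : ℕ} (S : ℝ → EuclideanSpace ℝ (Fin n) →L[ℝ] EuclideanSpace ℝ (Fin n))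
    (J J' : ℝ → EuclideanSpace ℝ (Fin n)) : Prop :=
  (∀ t, HasDerivAt J (J' t) t) ∧ ∀ t, HasDerivAt J' (S t (J t)) t

/-- `J` is a `P`-Jacobi field with derivative `J'`: a Jacobi field with `J a ∈ W` and
`⟪J' a, w⟫ + σ (J a) w = 0` for all `w ∈ W`. -/
def IsPJacobiPair {n : ℕ} (S : ℝ → EuclideanSpace ℝ (Fin n) →L[ℝ] EuclideanSpace ℝ (Fin n))
    (σ : EuclideanSpace ℝ (Fin n) →ₗ[ℝ] EuclideanSpace ℝ (Fin n) →ₗ[ℝ] ℝ)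
    (W : Submodule ℝ (EuclideanSpace ℝ (Fin n))) (a : ℝ)
    (J J' : ℝ → EuclideanSpace ℝ (Fin n)) : Prop :=
  IsJacobiPair S J J' ∧ J a ∈ W ∧ ∀ w ∈ W, (inner ℝ (J' a) w : ℝ) + σ (J a) w = 0

/-- `V` is piecewise `C¹` on `[a, b]`: continuous on `[a, b]` and `C¹` on each of the
closed subintervals of some partition `a = s₀ < s₁ < … < s_k = b`. -/
def PiecewiseC1On {F : Type*} [NormedAddCommGroup F] [NormedSpace ℝ F]
    (a b : ℝ) (V : ℝ → F) : Prop :=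
  ContinuousOn V (Icc a b) ∧
  ∃ (k : ℕ) (s : Fin (k + 1) → ℝ), s 0 = a ∧ s (Fin.last k) = b ∧ StrictMono s ∧
    ∀ i : Fin k, ContDiffOn ℝ 1 V (Icc (s i.castSucc) (s i.succ))

/-- The index form `I^P` on `[a, b]`. -/
noncomputable def indexForm {n : ℕ}
    (S : ℝ → EuclideanSpace ℝ (Fin n) →L[ℝ] EuclideanSpace ℝ (Fin n))
    (σ : EuclideanSpace ℝ (Fin n) →ₗ[ℝ] EuclideanSpace ℝ (Fin n) →ₗ[ℝ] ℝ)
    (a b : ℝ) (V U : ℝ → EuclideanSpace ℝ (Fin n)) : ℝ :=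
  (∫ t in a..b, ((inner ℝ (deriv V t) (deriv U t) : ℝ) + (inner ℝ (S t (V t)) (U t) : ℝ))) -
    σ (V a) (U a)


/-- The space `H^P` of piecewise `C¹` maps `V` on `[a, b]` with `V a ∈ W` and `V b = 0`. -/
def HP {n : ℕ} (W : Submodule ℝ (EuclideanSpace ℝ (Fin n))) (a b : ℝ) :
    Set (ℝ → EuclideanSpace ℝ (Fin n)) :=
  {V | PiecewiseC1On a b V ∧ V a ∈ W ∧ V b = 0}

/-- The space `H^{(P,Q)}` of piecewise `C¹` maps `V` on `[a, b]` with `V a ∈ W` and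
`V b ∈ W_Q`. -/
def HPQ {n : ℕ} (W WQ : Submodule ℝ (EuclideanSpace ℝ (Fin n))) (a b : ℝ) :
    Set (ℝ → EuclideanSpace ℝ (Fin n)) :=
  {V | PiecewiseC1On a b V ∧ V a ∈ W ∧ V b ∈ WQ}

/-- The index form `I^{(P,Q)}` for two variable endpoints. -/
noncomputable def indexFormPQ {n : ℕ}
    (S : ℝ → EuclideanSpace ℝ (Fin n) →L[ℝ] EuclideanSpace ℝ (Fin n))
    (σ σQ : EuclideanSpace ℝ (Fin n) →ₗ[ℝ] EuclideanSpace ℝ (Fin n) →ₗ[ℝ] ℝ)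
    (a b : ℝ) (V U : ℝ → EuclideanSpace ℝ (Fin n)) : ℝ :=
  indexForm S σ a b V U + σQ (V b) (U b)

/-- The space `𝒥^Q` of `P`-Jacobi fields `J` with `J b ∈ W_Q`. -/
def JQ {n : ℕ} (S : ℝ → EuclideanSpace ℝ (Fin n) →L[ℝ] EuclideanSpace ℝ (Fin n))
    (σ : EuclideanSpace ℝ (Fin n) →ₗ[ℝ] EuclideanSpace ℝ (Fin n) →ₗ[ℝ] ℝ)
    (W WQ : Submodule ℝ (EuclideanSpace ℝ (Fin n))) (a b : ℝ) :
    Set (ℝ → EuclideanSpace ℝ (Fin n)) :=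
  {V | ∃ J' : ℝ → EuclideanSpace ℝ (Fin n), IsPJacobiPair S σ W a V J' ∧ V b ∈ WQ}

/-- The bilinear form `A` on `𝒥^Q`, `A (J₁, J₂) = σ_Q (J₁ b, J₂ b) + ⟪J₁' b, J₂ b⟫`. -/
noncomputable def formA {n : ℕ}
    (σQ : EuclideanSpace ℝ (Fin n) →ₗ[ℝ] EuclideanSpace ℝ (Fin n) →ₗ[ℝ] ℝ)
    (b : ℝ) (J₁ J₂ : ℝ → EuclideanSpace ℝ (Fin n)) : ℝ :=
  σQ (J₁ b) (J₂ b) + (inner ℝ (deriv J₁ b) (J₂ b) : ℝ)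

/-- The index of a (not necessarily bilinear) form `B` on the set `K`: the supremum of the
dimensions of the finite-dimensional subspaces contained in `K` on which `B` is negative
definite, as an element of `ℕ∞`. -/
noncomputable def indexOn {X : Type*} [AddCommGroup X] [Module ℝ X]
    (B : X → X → ℝ) (K : Set X) : ℕ∞ :=
  ⨆ (U : Submodule ℝ X) (_ : (U : Set X) ⊆ K ∧ FiniteDimensional ℝ U ∧
      ∀ v ∈ U, v ≠ 0 → B v v < 0), (Module.finrank ℝ U : ℕ∞)

section IndexOfForms

variable {X : Type*} [AddCommGroup X] [Module ℝ X]

theorem indexOn_congr {B C : X → X → ℝ} {K : Set X} (h : ∀ v ∈ K, B v v = C v v) :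
    indexOn B K = indexOn C K := by
  unfold indexOn
  refine iSup_congr fun U => iSup_congr_Prop ?_ fun _ => rfl
  refine and_congr_right fun hU => and_congr_right fun _ => ?_
  exact forall₂_congr fun v hv => by rw [h v (hU hv)]

theorem finrank_le_indexOn {B : X → X → ℝ} {K : Set X} {U : Submodule ℝ X}
    (hU : (U : Set X) ⊆ K) (hfin : FiniteDimensional ℝ U) (hneg : ∀ v ∈ U, v ≠ 0 → B v v < 0) :
    (Module.finrank ℝ U : ℕ∞) ≤ indexOn B K :=
  le_iSup₂_of_le U ⟨hU, hfin, hneg⟩ le_rfl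

theorem bot_isNegDef {B : X → X → ℝ} {K : Set X} (h0 : (0 : X) ∈ K) :
    ((⊥ : Submodule ℝ X) : Set X) ⊆ K ∧ FiniteDimensional ℝ (⊥ : Submodule ℝ X) ∧
      ∀ v ∈ (⊥ : Submodule ℝ X), v ≠ 0 → B v v < 0 := by
  refine ⟨fun x hx => ?_, inferInstance, fun v hv hv0 => ?_⟩
  · rw [(Submodule.mem_bot ℝ).1 hx]
    exact h0
  · exact absurd ((Submodule.mem_bot ℝ).1 hv) hv0

theorem exists_finrank_eq_indexOn {B : X → X → ℝ} {K : Set X} (h0 : (0 : X) ∈ K)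
    (h : indexOn B K ≠ ⊤) :
    ∃ U : Submodule ℝ X, (U : Set X) ⊆ K ∧ FiniteDimensional ℝ U ∧
      (∀ v ∈ U, v ≠ 0 → B v v < 0) ∧ (Module.finrank ℝ U : ℕ∞) = indexOn B K := by
  unfold indexOn at h ⊢
  rw [iSup_subtype'] at h ⊢
  have : Nonempty {U : Submodule ℝ X // (U : Set X) ⊆ K ∧ FiniteDimensional ℝ U ∧
      ∀ v ∈ U, v ≠ 0 → B v v < 0} := ⟨⟨⊥, bot_isNegDef h0⟩⟩
  obtain ⟨⟨U, h1, h2, h3⟩, hU⟩ := ENat.exists_eq_iSup_of_lt_top h.lt_top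
  exact ⟨U, h1, h2, h3, hU⟩

/-- The sum of two orthogonal negative definite subspaces is negative definite. -/
theorem neg_on_sup_of_orthogonal (B : X →ₗ[ℝ] X →ₗ[ℝ] ℝ) (hB : ∀ x y, B x y = B y x)
    {M N : Submodule ℝ X} (hM : ∀ v ∈ M, v ≠ 0 → B v v < 0) (hN : ∀ v ∈ N, v ≠ 0 → B v v < 0)
    (hMN : ∀ x ∈ M, ∀ y ∈ N, B x y = 0) : ∀ v ∈ M ⊔ N, v ≠ 0 → B v v < 0 := by
  intro v hv hv0
  obtain ⟨x, hx, y, hy, rfl⟩ := Submodule.mem_sup.1 hv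
  have hxy := hMN x hx y hy
  have hyx : B y x = 0 := by rw [hB, hxy]
  have hexp : B (x + y) (x + y) = B x x + B y y := by
    simp only [map_add, LinearMap.add_apply, hxy, hyx]
    ring
  rw [hexp]
  by_cases hx0 : x = 0
  · have hy0 : y ≠ 0 := by
      rintro rfl
      exact hv0 (by simp [hx0])
    simpa [hx0] using hN y hy hy0
  · have h1 := hM x hx hx0
    by_cases hy0 : y = 0
    · simpa [hy0] using h1
    · exact add_neg h1 (hN y hy hy0)

theorem finrank_sup_of_orthogonal (B : X →ₗ[ℝ] X →ₗ[ℝ] ℝ)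
    {M N : Submodule ℝ X} [FiniteDimensional ℝ M] [FiniteDimensional ℝ N]
    (hM : ∀ v ∈ M, v ≠ 0 → B v v < 0) (hMN : ∀ x ∈ M, ∀ y ∈ N, B x y = 0) :
    Module.finrank ℝ (M ⊔ N : Submodule ℝ X) = Module.finrank ℝ M + Module.finrank ℝ N := by
  have hdisj : M ⊓ N = ⊥ := by
    rw [eq_bot_iff]
    rintro x ⟨hxM, hxN⟩
    by_contra hx
    exact (hM x hxM hx).ne (hMN x hxM x hxN)
  have h := Submodule.finrank_sup_add_finrank_inf_eq M N
  rw [hdisj, finrank_bot] at h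
  exact h

/-- A symmetric form is nonnegative on the orthogonal complement, within `K`, of a negative
definite subspace of maximal dimension of `K`. -/
theorem nonneg_of_orthogonal_of_finrank_eq_indexOn (B : X →ₗ[ℝ] X →ₗ[ℝ] ℝ)
    (hB : ∀ x y, B x y = B y x) {K M : Submodule ℝ X} (hMK : M ≤ K) [FiniteDimensional ℝ M]
    (hM : ∀ v ∈ M, v ≠ 0 → B v v < 0)
    (hmax : (Module.finrank ℝ M : ℕ∞) = indexOn (fun x y => B x y) (K : Set X))
    {x : X} (hx : x ∈ K) (hxM : ∀ m ∈ M, B m x = 0) : 0 ≤ B x x := by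
  by_contra! hneg
  have hx0 : x ≠ 0 := by
    rintro rfl
    simp at hneg
  have hspan : ∀ v ∈ Submodule.span ℝ {x}, v ≠ 0 → B v v < 0 := by
    intro v hv hv0
    obtain ⟨c, rfl⟩ := Submodule.mem_span_singleton.1 hv
    have hc : c ≠ 0 := by
      rintro rfl
      simp at hv0
    have : B (c • x) (c • x) = c ^ 2 * B x x := by
      simp only [map_smul, LinearMap.smul_apply, smul_eq_mul]
      ring
    rw [this]
    exact mul_neg_of_pos_of_neg (by positivity) hneg
  have horth : ∀ m ∈ M, ∀ v ∈ Submodule.span ℝ {x}, B m v = 0 := by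
    intro m hm v hv
    obtain ⟨c, rfl⟩ := Submodule.mem_span_singleton.1 hv
    simp [hxM m hm]
  have hle := finrank_le_indexOn (B := fun x y => B x y) (K := (K : Set X))
    (U := M ⊔ Submodule.span ℝ {x})
    (sup_le hMK ((Submodule.span_singleton_le_iff_mem x K).2 hx)) inferInstance
    (neg_on_sup_of_orthogonal B hB hM hspan horth)
  rw [← hmax, finrank_sup_of_orthogonal B hM horth, finrank_span_singleton hx0] at hle
  have := Nat.cast_le.1 hle
  omega

/-- The index of a symmetric bilinear form is additive under sums of orthogonal subspaces. -/
theorem indexOn_sup_of_orthogonal (B : X →ₗ[ℝ] X →ₗ[ℝ] ℝ) (hB : ∀ x y, B x y = B y x)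
    {K L : Submodule ℝ X} (hKL : ∀ x ∈ K, ∀ y ∈ L, B x y = 0) :
    indexOn (fun x y => B x y) ((K ⊔ L : Submodule ℝ X) : Set X) =
      indexOn (fun x y => B x y) (K : Set X) + indexOn (fun x y => B x y) (L : Set X) := by
  apply le_antisymm
  · by_cases hK : indexOn (fun x y => B x y) (K : Set X) = ⊤
    · simp [hK]
    by_cases hL : indexOn (fun x y => B x y) (L : Set X) = ⊤
    · simp [hL]
    obtain ⟨M, hMK, hMfin, hMneg, hM⟩ := exists_finrank_eq_indexOn K.zero_mem hK
    obtain ⟨N, hNL, hNfin, hNneg, hN⟩ := exists_finrank_eq_indexOn L.zero_mem hL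
    refine iSup₂_le fun U ⟨hU, hUfin, hUneg⟩ => ?_
    rw [← hM, ← hN]
    let Φ : U →ₗ[ℝ] Module.Dual ℝ M × Module.Dual ℝ N :=
      LinearMap.prod ((M.subtype.dualMap).comp (B.comp U.subtype))
        ((N.subtype.dualMap).comp (B.comp U.subtype))
    have hΦ : Function.Injective Φ := by
      rw [injective_iff_map_eq_zero]
      rintro ⟨u, hu⟩ h
      have hm : ∀ m ∈ M, B u m = 0 := fun m hm => LinearMap.congr_fun (congrArg Prod.fst h) ⟨m, hm⟩
      have hn : ∀ m ∈ N, B u m = 0 := fun m hm => LinearMap.congr_fun (congrArg Prod.snd h) ⟨m, hm⟩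
      obtain ⟨x, hx, y, hy, hxy⟩ := Submodule.mem_sup.1 (hU hu)
      have hxM : ∀ m ∈ M, B m x = 0 := by
        intro m hmM
        have h1 := hm m hmM
        rw [← hxy, map_add, LinearMap.add_apply, hB y m, hKL m (hMK hmM) y hy, add_zero] at h1
        rw [hB, h1]
      have hyN : ∀ m ∈ N, B m y = 0 := by
        intro m hmN
        have h1 := hn m hmN
        rw [← hxy, map_add, LinearMap.add_apply, hKL x hx m (hNL hmN), zero_add] at h1
        rw [hB, h1]
      have h1 := nonneg_of_orthogonal_of_finrank_eq_indexOn B hB hMK hMneg hM hx hxM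
      have h2 := nonneg_of_orthogonal_of_finrank_eq_indexOn B hB hNL hNneg hN hy hyN
      have h3 : B u u = B x x + B y y := by
        have hyx : B y x = 0 := by rw [hB, hKL x hx y hy]
        simp only [← hxy, map_add, LinearMap.add_apply, hKL x hx y hy, hyx]
        ring
      by_contra hu0
      have := hUneg u hu fun h => hu0 (Subtype.ext h)
      linarith
    have h := LinearMap.finrank_le_finrank_of_injective hΦ
    rw [Module.finrank_prod, Subspace.dual_finrank_eq, Subspace.dual_finrank_eq] at h
    exact_mod_cast h
  · refine ENat.biSup_add_biSup_le' ⟨⊥, bot_isNegDef K.zero_mem⟩ ⟨⊥, bot_isNegDef L.zero_mem⟩ ?_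
    rintro M ⟨hMK, hMfin, hMneg⟩ N ⟨hNL, hNfin, hNneg⟩
    have horth : ∀ x ∈ M, ∀ y ∈ N, B x y = 0 := fun x hx y hy => hKL x (hMK hx) y (hNL hy)
    rw [← Nat.cast_add, ← finrank_sup_of_orthogonal B hMneg horth]
    exact finrank_le_indexOn (sup_le_sup (c := N) (d := L) (a := M) (b := K) hMK hNL) inferInstance
      (neg_on_sup_of_orthogonal B hB hMneg hNneg horth)

/-- Version of `indexOn_sup_of_orthogonal` for a form that is only bilinear on the subspace
`V` spanned by the orthogonal subspaces. -/
theorem indexOn_eq_add_of_orthogonal {B : X → X → ℝ} {V K L : Submodule ℝ X}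
    (hadd : ∀ x ∈ V, ∀ y ∈ V, ∀ z ∈ V, B (x + y) z = B x z + B y z)
    (hsmul : ∀ (c : ℝ), ∀ x ∈ V, ∀ z ∈ V, B (c • x) z = c * B x z)
    (hB : ∀ x y, B x y = B y x) (hV : K ⊔ L = V)
    (hKL : ∀ x ∈ K, ∀ y ∈ L, B x y = 0) :
    indexOn B (V : Set X) = indexOn B (K : Set X) + indexOn B (L : Set X) := by
  let B₀ : V →ₗ[ℝ] V →ₗ[ℝ] ℝ := LinearMap.mk₂ ℝ (fun x y => B x y)
    (fun x y z => hadd x x.2 y y.2 z z.2) (fun c x z => hsmul c x x.2 z z.2)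
    (fun z x y => by
      rw [hB z, hB z, hB z]
      exact hadd x x.2 y y.2 z z.2)
    (fun c z x => by
      rw [hB z, hB z]
      exact hsmul c x x.2 z z.2)
  obtain ⟨p, hp⟩ := V.subtype.exists_leftInverse_of_injective V.ker_subtype
  have hpV : ∀ x ∈ V, (p x : X) = x := fun x hx =>
    congrArg Subtype.val (LinearMap.congr_fun hp ⟨x, hx⟩)
  let C : X →ₗ[ℝ] X →ₗ[ℝ] ℝ := B₀.compl₁₂ p p
  have hC : ∀ x ∈ V, ∀ y ∈ V, C x y = B x y := fun x hx y hy => by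
    change B (p x) (p y) = B x y
    rw [hpV x hx, hpV y hy]
  have hKV : K ≤ V := hV ▸ le_sup_left
  have hLV : L ≤ V := hV ▸ le_sup_right
  have h := indexOn_sup_of_orthogonal C (fun x y => hB _ _) (K := K) (L := L)
    fun x hx y hy => by rw [hC x (hKV hx) y (hLV hy), hKL x hx y hy]
  rw [hV] at h
  rw [← indexOn_congr (C := B) fun v hv => hC v hv v hv,
    ← indexOn_congr (C := B) fun v hv => hC v (hKV hv) v (hKV hv),
    ← indexOn_congr (C := B) fun v hv => hC v (hLV hv) v (hLV hv), h]

end IndexOfForms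

section PiecewiseC1

theorem exists_mem_Ioo_castSucc_succ {k : ℕ} (s : Fin (k + 1) → ℝ) {t : ℝ} (h0 : s 0 ≤ t)
    (hs : t ∉ range s) (j : Fin (k + 1)) (hj : t < s j) :
    ∃ i : Fin k, t ∈ Ioo (s i.castSucc) (s i.succ) := by
  induction j using Fin.induction with
  | zero => exact absurd hj h0.not_gt
  | succ i ih =>
    rcases lt_trichotomy t (s i.castSucc) with h | h | h
    · exact ih h
    · exact absurd ⟨_, h.symm⟩ hs
    · exact ⟨i, h, hj⟩

variable {F : Type*} [NormedAddCommGroup F] [NormedSpace ℝ F]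

/-- A piecewise `C¹` map is differentiable with bounded derivative off a finite set. -/
theorem PiecewiseC1On.exists_finite {a b : ℝ} {V : ℝ → F} (hV : PiecewiseC1On a b V) :
    ∃ s : Set ℝ, s.Finite ∧ (∀ t ∈ Icc a b \ s, DifferentiableAt ℝ V t) ∧
      ∃ C, ∀ t ∈ Icc a b \ s, ‖deriv V t‖ ≤ C := by
  obtain ⟨-, k, s, h0, hk, hs, hC1⟩ := hV
  have hmem : ∀ t ∈ Icc a b \ range s, ∃ i : Fin k, t ∈ Ioo (s i.castSucc) (s i.succ) := by
    rintro t ⟨⟨hat, htb⟩, ht⟩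
    refine exists_mem_Ioo_castSucc_succ s (h0.trans_le hat) ht (Fin.last k) ?_
    exact lt_of_le_of_ne (htb.trans_eq hk.symm) fun h => ht ⟨_, h.symm⟩
  have hbound : ∀ i : Fin k, ∃ C, ∀ t ∈ Icc (s i.castSucc) (s i.succ),
      ‖derivWithin V (Icc (s i.castSucc) (s i.succ)) t‖ ≤ C := fun i =>
    isCompact_Icc.exists_bound_of_continuousOn
      ((hC1 i).continuousOn_derivWithin (uniqueDiffOn_Icc (hs i.castSucc_lt_succ)) le_rfl)
  choose C hC using hbound
  refine ⟨range s, finite_range s, fun t ht => ?_, ∑ i, |C i|, fun t ht => ?_⟩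
  · obtain ⟨i, hi⟩ := hmem t ht
    exact ((hC1 i).differentiableOn one_ne_zero).differentiableAt (Icc_mem_nhds hi.1 hi.2)
  · obtain ⟨i, hi⟩ := hmem t ht
    rw [← derivWithin_of_mem_nhds (Icc_mem_nhds hi.1 hi.2)]
    refine (hC i t (Ioo_subset_Icc_self hi)).trans ((le_abs_self _).trans ?_)
    exact Finset.single_le_sum (f := fun i => |C i|) (fun i _ => abs_nonneg _) (Finset.mem_univ i)

end PiecewiseC1

section IndexForm

open MeasureTheory

variable {n : ℕ} {S : ℝ → EuclideanSpace ℝ (Fin n) →L[ℝ] EuclideanSpace ℝ (Fin n)}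
  {σ σQ : EuclideanSpace ℝ (Fin n) →ₗ[ℝ] EuclideanSpace ℝ (Fin n) →ₗ[ℝ] ℝ}
  {W WQ : Submodule ℝ (EuclideanSpace ℝ (Fin n))} {a b : ℝ}
  {U V V₁ V₂ J J' : ℝ → EuclideanSpace ℝ (Fin n)}

/-- The integrand of the index form of piecewise `C¹` maps is integrable. -/
theorem PiecewiseC1On.intervalIntegrable_indexForm (hS : Continuous S) (hab : a ≤ b)
    (hV : PiecewiseC1On a b V) (hU : PiecewiseC1On a b U) :
    IntervalIntegrable (fun t => (inner ℝ (deriv V t) (deriv U t) : ℝ) + inner ℝ (S t (V t)) (U t))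
      volume a b := by
  refine IntervalIntegrable.add ?_ ?_
  · obtain ⟨s, hs, -, C, hC⟩ := hV.exists_finite
    obtain ⟨r, hr, -, D, hD⟩ := hU.exists_finite
    rw [intervalIntegrable_iff_integrableOn_Icc_of_le hab]
    have hmeas : AEStronglyMeasurable (fun t => (inner ℝ (deriv V t) (deriv U t) : ℝ))
        (volume.restrict (Icc a b)) :=
      ((stronglyMeasurable_deriv V).inner (stronglyMeasurable_deriv U)).aestronglyMeasurable
    refine IntegrableOn.of_bound (by simp) hmeas (C * D) ?_
    have hnull : ∀ᵐ t ∂(volume.restrict (Icc a b)), t ∉ s ∪ r :=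
      ae_restrict_of_ae (measure_eq_zero_iff_ae_notMem.1 ((hs.union hr).measure_zero volume))
    filter_upwards [hnull, ae_restrict_mem measurableSet_Icc] with t ht htab
    have h1 := hC t ⟨htab, fun h => ht (Or.inl h)⟩
    have h2 := hD t ⟨htab, fun h => ht (Or.inr h)⟩
    refine (norm_inner_le_norm _ _).trans ?_
    gcongr
    exact (norm_nonneg _).trans h1
  · refine ContinuousOn.intervalIntegrable ?_
    rw [uIcc_of_le hab]
    exact (hS.continuousOn.clm_apply hV.1).inner hU.1

theorem indexForm_comm (hSsa : ∀ (t : ℝ) (x y : EuclideanSpace ℝ (Fin n)),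
      (inner ℝ (S t x) y : ℝ) = inner ℝ x (S t y)) (hσ : ∀ x y, σ x y = σ y x)
    (V U : ℝ → EuclideanSpace ℝ (Fin n)) : indexForm S σ a b V U = indexForm S σ a b U V := by
  unfold indexForm
  rw [hσ]
  congr 2
  funext t
  rw [hSsa, real_inner_comm, real_inner_comm (V t)]

theorem indexForm_add_left (hS : Continuous S) (hab : a ≤ b) (h₁ : PiecewiseC1On a b V₁)
    (h₂ : PiecewiseC1On a b V₂) (hU : PiecewiseC1On a b U) :
    indexForm S σ a b (V₁ + V₂) U = indexForm S σ a b V₁ U + indexForm S σ a b V₂ U := by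
  unfold indexForm
  rw [sub_add_sub_comm, ← intervalIntegral.integral_add
    (h₁.intervalIntegrable_indexForm hS hab hU) (h₂.intervalIntegrable_indexForm hS hab hU)]
  congr 1
  · obtain ⟨s, hs, hs', -⟩ := h₁.exists_finite
    obtain ⟨r, hr, hr', -⟩ := h₂.exists_finite
    refine intervalIntegral.integral_congr_ae ?_
    filter_upwards [measure_eq_zero_iff_ae_notMem.1 ((hs.union hr).measure_zero volume)] with t ht htab
    rw [uIoc_of_le hab] at htab
    have htab' := Ioc_subset_Icc_self htab
    rw [deriv_add (hs' t ⟨htab', fun h => ht (Or.inl h)⟩) (hr' t ⟨htab', fun h => ht (Or.inr h)⟩)]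
    simp only [Pi.add_apply, map_add, inner_add_left]
    ring
  · simp

theorem indexForm_smul_left (c : ℝ) (V U : ℝ → EuclideanSpace ℝ (Fin n)) :
    indexForm S σ a b (c • V) U = c * indexForm S σ a b V U := by
  unfold indexForm
  rw [mul_sub, ← intervalIntegral.integral_const_mul]
  congr 1
  · congr 1
    funext t
    have : deriv (c • V) t = c • deriv V t := deriv_const_smul_field c V
    simp only [this, Pi.smul_apply, map_smul, real_inner_smul_left]
    ring
  · simp

/-- Integration by parts against a Jacobi field. -/
theorem IsPJacobiPair.indexForm_eq (hS : Continuous S) (hab : a ≤ b)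
    (hJ : IsPJacobiPair S σ W a J J') (hJC : PiecewiseC1On a b J) (hV : PiecewiseC1On a b V)
    (hVa : V a ∈ W) : indexForm S σ a b J V = inner ℝ (J' b) (V b) := by
  obtain ⟨⟨hJ1, hJ2⟩, -, hJa⟩ := hJ
  obtain ⟨s, hs, hs', -⟩ := hV.exists_finite
  have hderiv : deriv J = J' := funext fun t => (hJ1 t).deriv
  have hint := hJC.intervalIntegrable_indexForm hS hab hV
  have hcont : Continuous J' := continuous_iff_continuousAt.2 fun t => (hJ2 t).continuousAt
  have h := integral_eq_of_hasDerivAt_off_countable_of_le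
    (fun t => (inner ℝ (J' t) (V t) : ℝ))
    (fun t => (inner ℝ (deriv J t) (deriv V t) : ℝ) + inner ℝ (S t (J t)) (V t))
    hab hs.countable (hcont.continuousOn.inner hV.1)
    (fun t ht => by
      rw [hderiv]
      exact (hJ2 t).inner ℝ (hs' t ⟨Ioo_subset_Icc_self ht.1, ht.2⟩).hasDerivAt) hint
  unfold indexForm
  rw [h]
  linarith [hJa (V a) hVa]

/-- The subspace underlying `JQ`. -/
def JQSubmodule (S : ℝ → EuclideanSpace ℝ (Fin n) →L[ℝ] EuclideanSpace ℝ (Fin n))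
    (σ : EuclideanSpace ℝ (Fin n) →ₗ[ℝ] EuclideanSpace ℝ (Fin n) →ₗ[ℝ] ℝ)
    (W WQ : Submodule ℝ (EuclideanSpace ℝ (Fin n))) (a b : ℝ) :
    Submodule ℝ (ℝ → EuclideanSpace ℝ (Fin n)) where
  carrier := JQ S σ W WQ a b
  add_mem' := by
    rintro J₁ J₂ ⟨J₁', ⟨⟨h1, h2⟩, h3, h4⟩, h5⟩ ⟨J₂', ⟨⟨k1, k2⟩, k3, k4⟩, k5⟩
    refine ⟨J₁' + J₂', ⟨⟨fun t => (h1 t).add (k1 t), fun t => ?_⟩, W.add_mem h3 k3,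
      fun w hw => ?_⟩, WQ.add_mem h5 k5⟩
    · simpa using (h2 t).add (k2 t)
    · simp only [Pi.add_apply, inner_add_left, map_add, LinearMap.add_apply]
      linarith [h4 w hw, k4 w hw]
  zero_mem' := by
    refine ⟨0, ⟨⟨fun t => hasDerivAt_const t _, fun t => ?_⟩, W.zero_mem, fun w hw => ?_⟩,
      WQ.zero_mem⟩
    · simp
    · simp
  smul_mem' := by
    rintro c J₁ ⟨J₁', ⟨⟨h1, h2⟩, h3, h4⟩, h5⟩
    refine ⟨c • J₁', ⟨⟨fun t => (h1 t).const_smul c, fun t => ?_⟩, W.smul_mem c h3,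
      fun w hw => ?_⟩, WQ.smul_mem c h5⟩
    · simpa using (h2 t).const_smul c
    · simp only [Pi.smul_apply, real_inner_smul_left, map_smul, LinearMap.smul_apply, smul_eq_mul]
      rw [← mul_add, h4 w hw, mul_zero]

end IndexForm

/-- **Index theorem for two variable endpoints** (ODE model): if
`W_Q ⊆ {J b : J a P-Jacobi field}`, then for every subspace `𝒱` of `H^{(P,Q)}` containing
`𝒥^Q`, one has `ind (I^{(P,Q)}, 𝒱) = ind (I^P, 𝒱 ∩ H^P) + ind (A, 𝒥^Q)`. -/
theorem index_theorem_two_variable_endpoints {n : ℕ}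
    (S : ℝ → EuclideanSpace ℝ (Fin n) →L[ℝ] EuclideanSpace ℝ (Fin n))
    (hS : ContDiff ℝ (⊤ : ℕ∞) S)
    (hSsa : ∀ (t : ℝ) (x y : EuclideanSpace ℝ (Fin n)),
      (inner ℝ (S t x) y : ℝ) = inner ℝ x (S t y))
    (σ σQ : EuclideanSpace ℝ (Fin n) →ₗ[ℝ] EuclideanSpace ℝ (Fin n) →ₗ[ℝ] ℝ)
    (hσ : ∀ x y, σ x y = σ y x) (hσQ : ∀ x y, σQ x y = σQ y x)
    (W WQ : Submodule ℝ (EuclideanSpace ℝ (Fin n)))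
    (a b : ℝ) (hab : a < b)
    (hWQ : ∀ v ∈ WQ, ∃ J J' : ℝ → EuclideanSpace ℝ (Fin n),
      IsPJacobiPair S σ W a J J' ∧ J b = v)
    (𝒱 : Submodule ℝ (ℝ → EuclideanSpace ℝ (Fin n)))
    (h𝒱₁ : (𝒱 : Set (ℝ → EuclideanSpace ℝ (Fin n))) ⊆ HPQ W WQ a b)
    (h𝒱₂ : JQ S σ W WQ a b ⊆ (𝒱 : Set (ℝ → EuclideanSpace ℝ (Fin n)))) :
    indexOn (indexFormPQ S σ σQ a b) (𝒱 : Set (ℝ → EuclideanSpace ℝ (Fin n))) =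
      indexOn (indexForm S σ a b) ((𝒱 : Set (ℝ → EuclideanSpace ℝ (Fin n))) ∩ HP W a b) +
      indexOn (formA σQ b) (JQ S σ W WQ a b) := by
  have hS' : Continuous S := hS.continuous
  have hPC : ∀ V ∈ 𝒱, PiecewiseC1On a b V := fun V hV => (h𝒱₁ hV).1
  let K : Submodule ℝ (ℝ → EuclideanSpace ℝ (Fin n)) :=
    𝒱 ⊓ LinearMap.ker (LinearMap.proj (R := ℝ) (φ := fun _ : ℝ => EuclideanSpace ℝ (Fin n)) b)
  let L := JQSubmodule S σ W WQ a b
  have hK : (K : Set (ℝ → EuclideanSpace ℝ (Fin n))) = ↑𝒱 ∩ HP W a b := by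
    ext V
    constructor
    · rintro ⟨hV, hVb⟩
      exact ⟨hV, (h𝒱₁ hV).1, (h𝒱₁ hV).2.1, hVb⟩
    · rintro ⟨hV, -, -, hVb⟩
      exact ⟨hV, hVb⟩
  have hJac : ∀ J ∈ JQ S σ W WQ a b, ∀ V ∈ 𝒱, indexFormPQ S σ σQ a b J V = formA σQ b J V := by
    intro J hJ V hV
    obtain ⟨J', hJ', -⟩ := id hJ
    unfold indexFormPQ formA
    rw [hJ'.indexForm_eq hS' hab.le (hPC J (h𝒱₂ hJ)) (hPC V hV) (h𝒱₁ hV).2.1, (hJ'.1.1 b).deriv,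
      add_comm]
  have hcomm : ∀ V U, indexFormPQ S σ σQ a b V U = indexFormPQ S σ σQ a b U V := fun V U => by
    unfold indexFormPQ
    rw [indexForm_comm hSsa hσ, hσQ]
  have hsup : K ⊔ L = 𝒱 := by
    refine le_antisymm (sup_le inf_le_left h𝒱₂) fun V hV => ?_
    obtain ⟨J, J', hJ, hJb⟩ := hWQ (V b) (h𝒱₁ hV).2.2
    have hJL : J ∈ L := ⟨J', hJ, hJb ▸ (h𝒱₁ hV).2.2⟩
    refine Submodule.mem_sup.2 ⟨V - J, ⟨𝒱.sub_mem hV (h𝒱₂ hJL), ?_⟩, J, hJL, sub_add_cancel V J⟩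
    change V b - J b = 0
    rw [hJb, sub_self]
  have hmain := indexOn_eq_add_of_orthogonal (B := indexFormPQ S σ σQ a b) (V := 𝒱) (K := K)
    (L := L)
    (fun x hx y hy z hz => by
      unfold indexFormPQ
      rw [indexForm_add_left hS' hab.le (hPC x hx) (hPC y hy) (hPC z hz), Pi.add_apply, map_add,
        LinearMap.add_apply]
      ring)
    (fun c x hx z hz => by
      unfold indexFormPQ
      rw [indexForm_smul_left, Pi.smul_apply, map_smul, LinearMap.smul_apply, smul_eq_mul]
      ring)
    hcomm hsup
    (fun V hV J hJ => by
      have hVb : V b = 0 := hV.2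
      rw [hcomm, hJac J hJ V hV.1, formA, hVb]
      simp)
  rw [hmain, hK]
  congr 1
  · refine indexOn_congr fun V hV => ?_
    unfold indexFormPQ
    rw [hV.2.2.2]
    simp
  · exact indexOn_congr fun J hJ => hJac J hJ J (h𝒱₂ hJ)
end

section
/- Let a = t₀ < t₁ < … < t_N = b be a partition of [a,b]. Let V_J ∈ H^P be such that the restriction of V_J to [t₀, t₁] coincides with the restriction of a P-Jacobi field and, for each 1 ≤ i ≤ N−1, the restriction of V_J to [t_i, t_{i+1}] coincides with the restriction of a Jacobi field. Let V₀ ∈ H^P satisfy V₀(t_i) = 0 for all i = 1, …, N. Then I^P(V_J, V₀) = 0. -/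
open Set

open MeasureTheory in
/-- A `C¹` function on a closed interval has an integrable derivative there. -/
lemma ContDiffOn.intervalIntegrable_deriv {F : Type*} [NormedAddCommGroup F] [NormedSpace ℝ F]
    {c d : ℝ} (hcd : c < d) {V : ℝ → F} (hV : ContDiffOn ℝ 1 V (Icc c d)) :
    IntervalIntegrable (deriv V) volume c d := by
  have hcont : ContinuousOn (derivWithin V (Icc c d)) (Icc c d) :=
    hV.continuousOn_derivWithin (uniqueDiffOn_Icc hcd) le_rfl
  refine (ContinuousOn.intervalIntegrable_of_Icc hcd.le hcont).congr_uIoo fun x hx => ?_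
  rw [uIoo_of_le hcd.le] at hx
  exact derivWithin_of_mem_nhds (Icc_mem_nhds hx.1 hx.2)

open MeasureTheory in
/-- A piecewise `C¹` function is differentiable off a countable set and its derivative is
integrable. -/
lemma PiecewiseC1On.exists_countable_differentiableAt {F : Type*} [NormedAddCommGroup F]
    [NormedSpace ℝ F] {a b : ℝ} {V : ℝ → F} (hV : PiecewiseC1On a b V) :
    IntervalIntegrable (deriv V) volume a b ∧
      ∃ D : Set ℝ, D.Countable ∧ ∀ x ∈ Ioo a b \ D, DifferentiableAt ℝ V x := by
  obtain ⟨-, k, s, rfl, rfl, hs, hC⟩ := hV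
  suffices h : ∀ i : Fin (k + 1), IntervalIntegrable (deriv V) volume (s 0) (s i) ∧
      ∀ x ∈ Ioo (s 0) (s i) \ range s, DifferentiableAt ℝ V x from
    ⟨(h _).1, range s, countable_range s, (h _).2⟩
  intro i
  induction i using Fin.induction with
  | zero => simp
  | succ i ih =>
    have hi : s i.castSucc < s i.succ := hs i.castSucc_lt_succ
    refine ⟨ih.1.trans ((hC i).intervalIntegrable_deriv hi), fun x hx => ?_⟩
    rcases lt_trichotomy x (s i.castSucc) with h | h | h
    · exact ih.2 x ⟨⟨hx.1.1, h⟩, hx.2⟩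
    · exact absurd ⟨_, h.symm⟩ hx.2
    · exact ((hC i).differentiableOn one_ne_zero).differentiableAt (Icc_mem_nhds h hx.1.2)

open MeasureTheory in
/-- The inner product of a continuous function and an integrable function is integrable. -/
lemma IntervalIntegrable.continuous_inner {E : Type*} [NormedAddCommGroup E]
    [InnerProductSpace ℝ E] {c d : ℝ} {f g : ℝ → E} (hf : Continuous f)
    (hg : IntervalIntegrable g volume c d) :
    IntervalIntegrable (fun x => (inner ℝ (f x) (g x) : ℝ)) volume c d := by
  refine (hg.norm.continuousOn_mul hf.norm.continuousOn).mono_fun ?_ ?_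
  · exact hf.aestronglyMeasurable.inner hg.def'.aestronglyMeasurable
  · refine Filter.Eventually.of_forall fun x => ?_
    simpa using norm_inner_le_norm (𝕜 := ℝ) (f x) (g x)

open MeasureTheory in
/-- Integration by parts for the index form on an interval where the first argument is a Jacobi
field. -/
lemma IsJacobiPair.integral_eq {n : ℕ}
    {S : ℝ → EuclideanSpace ℝ (Fin n) →L[ℝ] EuclideanSpace ℝ (Fin n)} (hS : Continuous S)
    {J J' V U : ℝ → EuclideanSpace ℝ (Fin n)} (hJ : IsJacobiPair S J J') {c d : ℝ} (hcd : c ≤ d)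
    (hVJ : ∀ x ∈ Icc c d, V x = J x) (hUc : ContinuousOn U (Icc c d))
    (hUi : IntervalIntegrable (deriv U) volume c d) {D : Set ℝ} (hD : D.Countable)
    (hUd : ∀ x ∈ Ioo c d \ D, DifferentiableAt ℝ U x) :
    IntervalIntegrable (fun x => (inner ℝ (deriv V x) (deriv U x) : ℝ) + inner ℝ (S x (V x)) (U x))
        volume c d ∧
      ∫ x in c..d, ((inner ℝ (deriv V x) (deriv U x) : ℝ) + inner ℝ (S x (V x)) (U x)) =
        inner ℝ (J' d) (U d) - inner ℝ (J' c) (U c) := by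
  have hJc : Continuous J := continuous_iff_continuousAt.2 fun x => (hJ.1 x).continuousAt
  have hJ'c : Continuous J' := continuous_iff_continuousAt.2 fun x => (hJ.2 x).continuousAt
  have hint : IntervalIntegrable
      (fun x => (inner ℝ (J' x) (deriv U x) : ℝ) + inner ℝ (S x (J x)) (U x)) volume c d :=
    (hUi.continuous_inner hJ'c).add
      (ContinuousOn.intervalIntegrable_of_Icc hcd ((hS.clm_apply hJc).continuousOn.inner hUc))
  have heq : EqOn (fun x => (inner ℝ (J' x) (deriv U x) : ℝ) + inner ℝ (S x (J x)) (U x))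
      (fun x => (inner ℝ (deriv V x) (deriv U x) : ℝ) + inner ℝ (S x (V x)) (U x))
      (uIoo c d) := by
    intro x hx
    rw [uIoo_of_le hcd] at hx
    have hVx : V =ᶠ[nhds x] J := by
      filter_upwards [Icc_mem_nhds hx.1 hx.2] with y hy using hVJ y hy
    simp only [hVx.deriv_eq, hVx.eq_of_nhds, (hJ.1 x).deriv]
  refine ⟨hint.congr_uIoo heq, ?_⟩
  rw [← intervalIntegral.integral_congr_uIoo heq]
  refine integral_eq_of_hasDerivAt_off_countable_of_le
    (fun x => (inner ℝ (J' x) (U x) : ℝ)) _ hcd hD (hJ'c.continuousOn.inner hUc) ?_ hint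
  intro x hx
  exact (hJ.2 x).inner ℝ (hUd x hx).hasDerivAt

/-- If `V_J ∈ H^P` is piecewise Jacobi with respect to a partition
`a = t₀ < t₁ < … < t_N = b` (`P`-Jacobi on `[t₀, t₁]`, Jacobi on each `[tᵢ, tᵢ₊₁]` for
`i ≥ 1`), and `V₀ ∈ H^P` vanishes at every `tᵢ` with `i ≥ 1`, then `I^P (V_J, V₀) = 0`. -/
theorem indexForm_piecewise_jacobi_orthogonal {n : ℕ}
    (S : ℝ → EuclideanSpace ℝ (Fin n) →L[ℝ] EuclideanSpace ℝ (Fin n))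
    (hS : ContDiff ℝ (⊤ : ℕ∞) S)
    (hSsa : ∀ (t : ℝ) (x y : EuclideanSpace ℝ (Fin n)),
      (inner ℝ (S t x) y : ℝ) = inner ℝ x (S t y))
    (σ : EuclideanSpace ℝ (Fin n) →ₗ[ℝ] EuclideanSpace ℝ (Fin n) →ₗ[ℝ] ℝ)
    (hσ : ∀ x y, σ x y = σ y x)
    (W : Submodule ℝ (EuclideanSpace ℝ (Fin n)))
    (a b : ℝ) (hab : a < b)
    (N : ℕ) (t : Fin (N + 1) → ℝ)
    (ht0 : t 0 = a) (htN : t (Fin.last N) = b) (hmono : StrictMono t)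
    (VJ : ℝ → EuclideanSpace ℝ (Fin n)) (hVJ : VJ ∈ HP W a b)
    (hVJ0 : ∃ J J' : ℝ → EuclideanSpace ℝ (Fin n), IsPJacobiPair S σ W a J J' ∧
      ∀ s ∈ Icc (t 0) (t (1 : Fin (N + 1))), VJ s = J s)
    (hVJi : ∀ i : Fin N, (i : ℕ) ≠ 0 → ∃ J J' : ℝ → EuclideanSpace ℝ (Fin n),
      IsJacobiPair S J J' ∧ ∀ s ∈ Icc (t i.castSucc) (t i.succ), VJ s = J s)
    (V₀ : ℝ → EuclideanSpace ℝ (Fin n)) (hV₀ : V₀ ∈ HP W a b)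
    (hV₀t : ∀ i : Fin (N + 1), i ≠ 0 → V₀ (t i) = 0) :
    indexForm S σ a b VJ V₀ = 0 := by
  obtain ⟨hUi, D, hD, hUd⟩ := hV₀.1.exists_countable_differentiableAt
  have hUc := hV₀.1.1
  obtain ⟨J₀, J₀', ⟨hJ₀, -, hJ₀W⟩, hVJ₀⟩ := hVJ0
  subst ht0 htN
  have hpiece : ∀ i : Fin N, ∀ J J' : ℝ → EuclideanSpace ℝ (Fin n), IsJacobiPair S J J' →
      (∀ s ∈ Icc (t i.castSucc) (t i.succ), VJ s = J s) → _ := fun i J J' hJ hV =>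
    have hsub : Icc (t i.castSucc) (t i.succ) ⊆ Icc (t 0) (t (Fin.last N)) :=
      Icc_subset_Icc (hmono.monotone (Fin.zero_le _)) (hmono.monotone (Fin.le_last _))
    hJ.integral_eq hS.continuous (hmono i.castSucc_lt_succ).le hV (hUc.mono hsub)
      (hUi.mono_set (by
        rwa [uIcc_of_le (hmono i.castSucc_lt_succ).le, uIcc_of_le hab.le])) hD
      fun x hx => hUd x ⟨Ioo_subset_Ioo (hmono.monotone (Fin.zero_le _))
        (hmono.monotone (Fin.le_last _)) hx.1, hx.2⟩
  have hinit : VJ (t 0) = J₀ (t 0) := hVJ₀ _ ⟨le_rfl, hmono.monotone (Fin.zero_le _)⟩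
  have hbdry : σ (VJ (t 0)) (V₀ (t 0)) = -inner ℝ (J₀' (t 0)) (V₀ (t 0)) := by
    rw [hinit]
    linarith [hJ₀W _ hV₀.2.1]
  have main : ∀ i : Fin (N + 1),
      IntervalIntegrable (fun x => (inner ℝ (deriv VJ x) (deriv V₀ x) : ℝ) +
        inner ℝ (S x (VJ x)) (V₀ x)) MeasureTheory.volume (t 0) (t i) ∧
      (i ≠ 0 → ∫ x in (t 0)..(t i), ((inner ℝ (deriv VJ x) (deriv V₀ x) : ℝ) +
        inner ℝ (S x (VJ x)) (V₀ x)) = σ (VJ (t 0)) (V₀ (t 0))) := by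
    intro i
    induction i using Fin.induction with
    | zero => simp
    | succ i ih =>
      have hend : V₀ (t i.succ) = 0 := hV₀t _ i.succ_ne_zero
      by_cases hi : (i : ℕ) = 0
      · have hc : i.castSucc = 0 := Fin.ext hi
        have hs : i.succ = 1 := by
          obtain ⟨M, rfl⟩ : ∃ M, N = M + 1 := ⟨N - 1, by have := i.2; omega⟩
          ext
          simp [hi]
        obtain ⟨h1, h2⟩ := hpiece i J₀ J₀' hJ₀ (by rwa [hc, hs])
        rw [hend, hc, inner_zero_right, zero_sub] at h2
        rw [hc] at h1
        exact ⟨h1, fun _ => h2.trans hbdry.symm⟩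
      · obtain ⟨J, J', hJ, hV⟩ := hVJi i hi
        have hc : i.castSucc ≠ 0 := fun h => hi (congrArg Fin.val h)
        obtain ⟨h1, h2⟩ := hpiece i J J' hJ hV
        rw [hend, hV₀t _ hc, inner_zero_right, inner_zero_right, sub_zero] at h2
        refine ⟨ih.1.trans h1, fun _ => ?_⟩
        rw [← intervalIntegral.integral_add_adjacent_intervals ih.1 h1, h2, add_zero, ih.2 hc]
  have hlast : Fin.last N ≠ 0 := fun h => hab.ne (by rw [h])
  rw [indexForm, (main _).2 hlast, sub_self]
end

section
/- For t ∈ (a,b], let H^P_t be the space of piecewise C¹ maps V : [a,t] → E with V(a) ∈ W and V(t) = 0, let I^P_t(V,U) = ∫_a^t (⟪V'(s), U'(s)⟫ + ⟪S(s) V(s), U(s)⟫) ds − σ(V(a), U(a)), and set i(t) = ind(I^P_t, H^P_t). Then the function i : (a,b] → ℕ ∪ {∞} is nondecreasing: if a < t ≤ s ≤ b then i(t) ≤ i(s). -/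
open Set

/-- The space `H^P_t` of piecewise `C¹` maps `V` on `[a, t]` with `V a ∈ W` and `V t = 0`. -/
def HPt {n : ℕ} (W : Submodule ℝ (EuclideanSpace ℝ (Fin n))) (a t : ℝ) :
    Set (ℝ → EuclideanSpace ℝ (Fin n)) :=
  {V | PiecewiseC1On a t V ∧ V a ∈ W ∧ V t = 0}

/-- The restricted Morse index function `i(t) = ind (I^P_{[a,t]}, H^P_t)`. -/
noncomputable def morseIndexFun {n : ℕ}
    (S : ℝ → EuclideanSpace ℝ (Fin n) →L[ℝ] EuclideanSpace ℝ (Fin n))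
    (σ : EuclideanSpace ℝ (Fin n) →ₗ[ℝ] EuclideanSpace ℝ (Fin n) →ₗ[ℝ] ℝ)
    (W : Submodule ℝ (EuclideanSpace ℝ (Fin n))) (a t : ℝ) : ℕ∞ :=
  indexOn (indexForm S σ a t) (HPt W a t)

/-- Truncation at `t`: keep a function on `(-∞, t]` and replace it by `0` on `(t, ∞)`. -/
noncomputable def truncateAfter (F : Type*) [AddCommGroup F] [Module ℝ F] (t : ℝ) :
    (ℝ → F) →ₗ[ℝ] (ℝ → F) where
  toFun V := (Iic t).indicator V
  map_add' V U := indicator_add (Iic t) V U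
  map_smul' c V := indicator_const_smul (Iic t) c V

theorem truncateAfter_of_le {F : Type*} [AddCommGroup F] [Module ℝ F] {t x : ℝ}
    (V : ℝ → F) (hx : x ≤ t) : truncateAfter F t V x = V x :=
  indicator_of_mem (s := Iic t) hx V

theorem truncateAfter_of_lt {F : Type*} [AddCommGroup F] [Module ℝ F] {t x : ℝ}
    (V : ℝ → F) (hx : t < x) : truncateAfter F t V x = 0 :=
  indicator_of_notMem (s := Iic t) (not_le.mpr hx) V

/-- A piecewise `C¹` map on `[a, t]` vanishing at `t` stays piecewise `C¹` on a larger interval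
when extended by zero. -/
theorem PiecewiseC1On.truncateAfter {F : Type*} [NormedAddCommGroup F] [NormedSpace ℝ F]
    {a t s : ℝ} {V : ℝ → F} (hV : PiecewiseC1On a t V) (hat : a ≤ t) (hts : t < s)
    (hVt : V t = 0) : PiecewiseC1On a s (truncateAfter F t V) := by
  obtain ⟨hc, k, p, hp0, hpk, hp, hd⟩ := hV
  have hleft : EqOn (_root_.truncateAfter F t V) V (Iic t) := fun x hx => truncateAfter_of_le V hx
  have hright : EqOn (_root_.truncateAfter F t V) (fun _ => 0) (Icc t s) := by
    intro x hx
    rcases hx.1.eq_or_lt with rfl | h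
    · exact (truncateAfter_of_le V le_rfl).trans hVt
    · exact truncateAfter_of_lt V h
  refine ⟨?_, k + 1, Fin.snoc p s, ?_, by simp, ?_, ?_⟩
  · rw [← Icc_union_Icc_eq_Icc hat hts.le]
    exact (hc.congr (hleft.mono Icc_subset_Iic_self)).union_of_isClosed
      (continuousOn_const.congr hright) isClosed_Icc isClosed_Icc
  · rw [← Fin.castSucc_zero, Fin.snoc_castSucc, hp0]
  · rw [Fin.strictMono_iff_lt_succ]
    intro i
    induction i using Fin.lastCases with
    | last => simpa [hpk] using hts
    | cast j =>
      rw [← Fin.castSucc_succ, Fin.snoc_castSucc, Fin.snoc_castSucc]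
      exact hp j.castSucc_lt_succ
  · intro i
    induction i using Fin.lastCases with
    | last =>
      rw [Fin.succ_last, Fin.snoc_last, Fin.snoc_castSucc, hpk]
      exact contDiffOn_const.congr hright
    | cast j =>
      rw [← Fin.castSucc_succ, Fin.snoc_castSucc, Fin.snoc_castSucc]
      refine (hd j).congr fun x hx => hleft ?_
      exact hx.2.trans (hpk ▸ hp.monotone (Fin.le_last _))

theorem indexForm_truncateAfter {n : ℕ}
    (S : ℝ → EuclideanSpace ℝ (Fin n) →L[ℝ] EuclideanSpace ℝ (Fin n))
    (σ : EuclideanSpace ℝ (Fin n) →ₗ[ℝ] EuclideanSpace ℝ (Fin n) →ₗ[ℝ] ℝ)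
    {a t s : ℝ} (hat : a ≤ t) (hts : t ≤ s) (V U : ℝ → EuclideanSpace ℝ (Fin n)) :
    indexForm S σ a s (truncateAfter _ t V) (truncateAfter _ t U) = indexForm S σ a t V U := by
  unfold indexForm
  rw [truncateAfter_of_le V hat, truncateAfter_of_le U hat,
    intervalIntegral.integral_of_le (hat.trans hts), intervalIntegral.integral_of_le hat]
  congr 1
  rw [MeasureTheory.setIntegral_eq_of_subset_of_forall_sdiff_eq_zero measurableSet_Ioc
    (Ioc_subset_Ioc_right hts), MeasureTheory.integral_Ioc_eq_integral_Ioo,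
    MeasureTheory.integral_Ioc_eq_integral_Ioo]
  · refine MeasureTheory.setIntegral_congr_fun measurableSet_Ioo fun x hx => ?_
    have hev (Z : ℝ → EuclideanSpace ℝ (Fin n)) : truncateAfter _ t Z =ᶠ[nhds x] Z :=
      Filter.eventually_of_mem (Iio_mem_nhds hx.2) fun y hy => truncateAfter_of_le Z (le_of_lt hy)
    simp only [(hev V).deriv_eq, (hev U).deriv_eq, (hev V).eq_of_nhds, (hev U).eq_of_nhds]
  · intro x hx
    have htx : t < x := not_le.mp fun h => hx.2 ⟨hx.1.1, h⟩
    have hev : truncateAfter _ t V =ᶠ[nhds x] fun _ => 0 :=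
      Filter.eventually_of_mem (Ioi_mem_nhds htx) fun y hy => truncateAfter_of_lt V hy
    simp [hev.deriv_eq, hev.eq_of_nhds]

/-- The index does not decrease along a linear map that preserves the form and the constraint
set; a zero of the map in a negative definite subspace vanishes automatically. -/
theorem indexOn_le_of_linearMap {X Y : Type*} [AddCommGroup X] [Module ℝ X]
    [AddCommGroup Y] [Module ℝ Y] {B : X → X → ℝ} {C : Y → Y → ℝ} {K : Set X} {L : Set Y}
    (T : X →ₗ[ℝ] Y) (hC : C 0 0 = 0) (hB : ∀ v, C (T v) (T v) = B v v) (hT : MapsTo T K L) :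
    indexOn B K ≤ indexOn C L := by
  refine iSup₂_le fun U ⟨hUK, hfin, hneg⟩ => ?_
  have hker : LinearMap.ker (T.domRestrict U) = ⊥ := by
    rw [LinearMap.ker_eq_bot']
    intro v hv
    replace hv : T v = 0 := hv
    by_contra hne
    have hlt := hneg v v.2 fun h => hne (Subtype.ext h)
    rw [← hB, hv, hC] at hlt
    exact lt_irrefl _ hlt
  have hrank : Module.finrank ℝ (U.map T) = Module.finrank ℝ U := by
    rw [← LinearMap.range_domRestrict]
    exact LinearMap.finrank_range_of_inj (LinearMap.ker_eq_bot.mp hker)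
  rw [← hrank]
  refine le_iSup₂_of_le (U.map T) ⟨?_, inferInstance, ?_⟩ le_rfl
  · rintro _ ⟨v, hv, rfl⟩
    exact hT (hUK hv)
  · rintro _ ⟨v, hv, rfl⟩ hne
    rw [hB]
    exact hneg v hv fun h => hne (by rw [h, map_zero])

/-- The restricted Morse index function `i(t) = ind (I^P_{[a,t]}, H^P_t)` is nondecreasing
on `(a, b]`. -/
theorem morseIndexFun_monotone {n : ℕ}
    (S : ℝ → EuclideanSpace ℝ (Fin n) →L[ℝ] EuclideanSpace ℝ (Fin n))
    (hS : ContDiff ℝ (⊤ : ℕ∞) S)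
    (hSsa : ∀ (t : ℝ) (x y : EuclideanSpace ℝ (Fin n)),
      (inner ℝ (S t x) y : ℝ) = inner ℝ x (S t y))
    (σ : EuclideanSpace ℝ (Fin n) →ₗ[ℝ] EuclideanSpace ℝ (Fin n) →ₗ[ℝ] ℝ)
    (hσ : ∀ x y, σ x y = σ y x)
    (W : Submodule ℝ (EuclideanSpace ℝ (Fin n)))
    (a b : ℝ) (hab : a < b) :
    ∀ t s : ℝ, a < t → t ≤ s → s ≤ b →
      morseIndexFun S σ W a t ≤ morseIndexFun S σ W a s := by
  intro t s hat hts _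
  rcases hts.eq_or_lt with rfl | hlt
  · exact le_rfl
  refine indexOn_le_of_linearMap (truncateAfter _ t) (by simp [indexForm])
    (fun V => indexForm_truncateAfter S σ hat.le hts V V) ?_
  rintro V ⟨hV, hVa, hVt⟩
  exact ⟨hV.truncateAfter hat.le hlt hVt, by rwa [truncateAfter_of_le V hat.le],
    truncateAfter_of_lt V hlt⟩
end
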